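/- For P > 0 and α₁, α₂ ∈ [0,1], the strategy pair (BW, BW) is a Nash equilibrium of the game Γ₁ if and only if Λ₁(α₁,α₂) ≤ min(α₁², α₂²)·P/(1+P). -/

import Mathlib

/-- `C x = (1/2) * log (1 + x)` (natural logarithm). -/
noncomputable def C (x : ℝ) : ℝ := (1/2) * Real.log (1 + x)

/-- `Λ₁(α₁,α₂)` for power `P`. -/
noncomputable def Lam1 (P a1 a2 : ℝ) : ℝ :=
  P ^ 2 * (a1 + a2) ^ 2 /
    (1 + (2 + a1 ^ 2 + a2 ^ 2) * P + (1 - a1 * a2) ^ 2 * P ^ 2)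

/-- Pure strategies of the game Γ₁. -/
inductive Strat where
  | FW : Strat
  | BW : Strat

/-- Payoff (secret key rate) of player 1 in the game Γ₁. -/
noncomputable def R1 (P a1 a2 : ℝ) : Strat → Strat → ℝ
  | Strat.FW, Strat.FW => C (P / (1 + a1 ^ 2 * P)) - C (a2 ^ 2 * P)
  | Strat.FW, Strat.BW => C (P / (1 + a1 ^ 2 * P)) - C (a2 ^ 2 * P / (1 + P))
  | Strat.BW, Strat.FW => C (P / (1 + a1 ^ 2 * P)) -
      C ((a1 ^ 2 * P + a2 ^ 2 * P ^ 2 + a1 ^ 2 * a2 ^ 2 * P ^ 2) / (1 + P + a2 ^ 2 * P))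
  | Strat.BW, Strat.BW => C (P / (1 + a1 ^ 2 * P)) - C (Lam1 P a1 a2)

/-- Payoff (secret key rate) of player 2 in the game Γ₁. -/
noncomputable def R2 (P a1 a2 : ℝ) : Strat → Strat → ℝ
  | Strat.FW, Strat.FW => C (P / (1 + a2 ^ 2 * P)) - C (a1 ^ 2 * P)
  | Strat.BW, Strat.FW => C (P / (1 + a2 ^ 2 * P)) - C (a1 ^ 2 * P / (1 + P))
  | Strat.FW, Strat.BW => C (P / (1 + a2 ^ 2 * P)) -
      C ((a2 ^ 2 * P + a1 ^ 2 * P ^ 2 + a1 ^ 2 * a2 ^ 2 * P ^ 2) / (1 + P + a1 ^ 2 * P))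
  | Strat.BW, Strat.BW => C (P / (1 + a2 ^ 2 * P)) - C (Lam1 P a1 a2)

/-- `(s1, s2)` is a Nash equilibrium of the game Γ₁. -/
def IsNE (P a1 a2 : ℝ) (s1 s2 : Strat) : Prop :=
  (∀ t1 : Strat, R1 P a1 a2 s1 s2 ≥ R1 P a1 a2 t1 s2) ∧
  (∀ t2 : Strat, R2 P a1 a2 s1 s2 ≥ R2 P a1 a2 s1 t2)

theorem C_le_C_iff {x y : ℝ} (hx : 0 ≤ x) (hy : 0 ≤ y) : C x ≤ C y ↔ x ≤ y := by
  unfold C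
  rw [mul_le_mul_iff_right₀ (by norm_num), Real.log_le_log_iff (by linarith) (by linarith),
    add_le_add_iff_left]

theorem Lam1_nonneg {P : ℝ} (hP : 0 ≤ P) (a1 a2 : ℝ) : 0 ≤ Lam1 P a1 a2 := by
  unfold Lam1
  positivity

theorem Strat.forall_iff {p : Strat → Prop} : (∀ t, p t) ↔ p FW ∧ p BW :=
  ⟨fun h => ⟨h FW, h BW⟩, fun h t => by cases t; exacts [h.1, h.2]⟩

/-- For `P > 0` and `α₁, α₂ ∈ [0,1]`, the strategy pair `(BW, BW)` is a Nash
equilibrium of Γ₁ iff `Λ₁(α₁,α₂) ≤ min(α₁², α₂²)·P/(1+P)`. -/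
theorem stmt12 (P a1 a2 : ℝ) (hP : 0 < P)
    (h1 : a1 ∈ Set.Icc (0 : ℝ) 1) (h2 : a2 ∈ Set.Icc (0 : ℝ) 1) :
    IsNE P a1 a2 Strat.BW Strat.BW ↔
      Lam1 P a1 a2 ≤ min (a1 ^ 2) (a2 ^ 2) * P / (1 + P) := by
  have hL : 0 ≤ Lam1 P a1 a2 := Lam1_nonneg hP.le a1 a2
  have hmin : min (a1 ^ 2) (a2 ^ 2) * P / (1 + P) =
      min (a1 ^ 2 * P / (1 + P)) (a2 ^ 2 * P / (1 + P)) := by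
    rw [min_mul_of_nonneg _ _ hP.le, min_div_div_right (by positivity)]
  simp only [IsNE, Strat.forall_iff, R1, R2, ge_iff_le, le_refl, and_true,
    sub_le_sub_iff_left]
  rw [C_le_C_iff hL (by positivity), C_le_C_iff hL (by positivity), hmin, le_min_iff, and_comm]
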